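/- Let ψ : ℕ → ℝ⁺ with ψ(n)/(log n) → ∞ as n → ∞, and define A ∈ [1,∞] by log A = liminf_{n→∞} (log ψ(n))/n. Then E_sup(Λ,ψ) = {x ∈ Λ : limsup_{n→∞} (log a_n(x))/ψ(n) = 1} has Hausdorff dimension 1/(A+1). -/

import Mathlib

open Filter MeasureTheory Set
open scoped ENNReal

/-- The Gauss map. -/
noncomputable def gaussMap (x : ℝ) : ℝ := Int.fract x⁻¹

/-- The `n`-th partial quotient (for `n ≥ 1`) of the continued fraction expansion of `x`. -/
noncomputable def cfA (n : ℕ) (x : ℝ) : ℕ := ⌊(gaussMap^[n - 1] x)⁻¹⌋₊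

/-- The set `Λ` of points of `(0,1)` whose partial quotients are non-decreasing. -/
noncomputable def Lam : Set ℝ :=
  {x | x ∈ Set.Ioo (0:ℝ) 1 ∧ ∀ n : ℕ, 1 ≤ n → cfA n x ≤ cfA (n + 1) x}


lemma Lam_one_le {x : ℝ} (hx : x ∈ Lam) (n : ℕ) : 1 ≤ cfA (n + 1) x := by
  induction n with
  | zero =>
    have h := hx.1
    simp only [cfA]
    rw [Nat.one_le_floor_iff]
    simpa using (one_le_inv₀ h.1).2 h.2.le
  | succ n ih => exact ih.trans (hx.2 (n + 1) (by omega))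

lemma Lam_mono {x : ℝ} (hx : x ∈ Lam) : Monotone (fun n => cfA (n + 1) x) :=
  monotone_nat_of_le_succ fun n => hx.2 (n + 1) (by omega)

lemma Lam_t {x : ℝ} (hx : x ∈ Lam) (n : ℕ) :
    0 < gaussMap^[n] x ∧ gaussMap^[n] x < 1 := by
  have h1 := Lam_one_le hx n
  simp only [cfA, Nat.add_sub_cancel] at h1
  rw [Nat.one_le_floor_iff] at h1
  constructor
  · exact inv_pos.1 (by linarith)
  · cases n with
    | zero => exact hx.1.2
    | succ n => rw [Function.iterate_succ_apply']; exact Int.fract_lt_one _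

lemma Lam_step {x : ℝ} (hx : x ∈ Lam) (n : ℕ) :
    gaussMap^[n] x = ((cfA (n + 1) x : ℝ) + gaussMap^[n + 1] x)⁻¹ := by
  have h := Lam_t hx n
  rw [Function.iterate_succ_apply', cfA, gaussMap, Nat.add_sub_cancel,
    natCast_floor_eq_intCast_floor (inv_pos.2 h.1).le, Int.floor_add_fract, inv_inv]

/-- Comparison of two continued fraction orbits sharing their first digits. -/
lemma cf_diff (t t' a : ℕ → ℝ) (n : ℕ) (ha : ∀ i < n, 1 ≤ a i)
    (ht : ∀ i, 0 ≤ t i ∧ t i ≤ 1) (ht' : ∀ i, 0 ≤ t' i ∧ t' i ≤ 1)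
    (h : ∀ i < n, t i = (a i + t (i + 1))⁻¹) (h' : ∀ i < n, t' i = (a i + t' (i + 1))⁻¹) :
    |t 0 - t' 0| ≤ |t n - t' n| * (∏ i ∈ Finset.range n, a i)⁻¹ ^ 2 ∧
    |t n - t' n| * (∏ i ∈ Finset.range n, (a i + 1))⁻¹ ^ 2 ≤ |t 0 - t' 0| := by
  induction n with
  | zero => simp
  | succ n ih =>
    obtain ⟨i1, i2⟩ := ih (fun i hi => ha i (by omega)) (fun i hi => h i (by omega))
      (fun i hi => h' i (by omega))
    have e1 := h n (by omega)
    have e2 := h' n (by omega)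
    have han := ha n (by omega)
    have p1 : 0 < a n + t (n + 1) := by linarith [(ht (n + 1)).1]
    have p2 : 0 < a n + t' (n + 1) := by linarith [(ht' (n + 1)).1]
    have key : |t n - t' n| = |t (n + 1) - t' (n + 1)| *
        ((a n + t (n + 1))⁻¹ * (a n + t' (n + 1))⁻¹) := by
      have : t n - t' n = - ((t (n + 1) - t' (n + 1)) *
        ((a n + t (n + 1))⁻¹ * (a n + t' (n + 1))⁻¹)) := by
        rw [e1, e2]; field_simp; ring
      rw [this, abs_neg, abs_mul, abs_of_pos (a := _ * _) (by positivity)]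
    have l1 : (a n + t (n + 1))⁻¹ ≤ (a n)⁻¹ :=
      inv_anti₀ (by linarith) (by linarith [(ht (n + 1)).1])
    have l2 : (a n + t' (n + 1))⁻¹ ≤ (a n)⁻¹ :=
      inv_anti₀ (by linarith) (by linarith [(ht' (n + 1)).1])
    have m1 : (a n + 1)⁻¹ ≤ (a n + t (n + 1))⁻¹ :=
      inv_anti₀ p1 (by linarith [(ht (n + 1)).2])
    have m2 : (a n + 1)⁻¹ ≤ (a n + t' (n + 1))⁻¹ :=
      inv_anti₀ p2 (by linarith [(ht' (n + 1)).2])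
    have an0 : 0 < (a n)⁻¹ := by positivity
    have an1 : 0 < (a n + 1)⁻¹ := by positivity
    have q1 : 0 < (a n + t (n + 1))⁻¹ := by positivity
    have q2 : 0 < (a n + t' (n + 1))⁻¹ := by positivity
    rw [Finset.prod_range_succ, Finset.prod_range_succ, mul_inv, mul_inv, mul_pow, mul_pow]
    constructor
    · refine i1.trans ?_
      have : |t n - t' n| ≤ |t (n + 1) - t' (n + 1)| * (a n)⁻¹ ^ 2 := by
        rw [key, sq]; gcongr
      calc _ ≤ (|t (n + 1) - t' (n + 1)| * (a n)⁻¹ ^ 2) *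
            (∏ i ∈ Finset.range n, a i)⁻¹ ^ 2 := by gcongr
        _ = _ := by ring
    · refine le_trans ?_ i2
      have : |t (n + 1) - t' (n + 1)| * (a n + 1)⁻¹ ^ 2 ≤ |t n - t' n| := by
        rw [key, sq]; gcongr
      calc _ = (|t (n + 1) - t' (n + 1)| * (a n + 1)⁻¹ ^ 2) *
            (∏ i ∈ Finset.range n, (a i + 1))⁻¹ ^ 2 := by ring
        _ ≤ _ := by gcongr

/-- Covering set attached to a word. -/
def Jset (τ K : ℝ) (p : Σ n : ℕ, (Fin n → ℕ)) : Set ℝ :=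
  {x | x ∈ Lam ∧ (∀ i : Fin p.1, cfA (i + 1) x = p.2 i + 1) ∧
    K * p.1 + (τ - 2) * (∑ i : Fin p.1, Real.log (p.2 i + 1)) ≤ Real.log (cfA (p.1 + 1) x)}

lemma Jset_dist {τ K : ℝ} {p : Σ n : ℕ, (Fin n → ℕ)} {x y : ℝ} (hx : x ∈ Jset τ K p)
    (hy : y ∈ Jset τ K p) :
    |x - y| ≤ Real.exp (-K * p.1) * ∏ i : Fin p.1, ((p.2 i : ℝ) + 1) ^ (-τ) := by
  obtain ⟨n, w⟩ := p
  obtain ⟨hx0, hx1, hx2⟩ := hx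
  obtain ⟨hy0, hy1, hy2⟩ := hy
  dsimp only at *
  have hc := (cf_diff (fun n => gaussMap^[n] x) (fun n => gaussMap^[n] y)
    (fun n => (cfA (n + 1) x : ℝ)) n (fun i _ => by exact_mod_cast Lam_one_le hx0 i)
    (fun i => ⟨(Lam_t hx0 i).1.le, (Lam_t hx0 i).2.le⟩)
    (fun i => ⟨(Lam_t hy0 i).1.le, (Lam_t hy0 i).2.le⟩)
    (fun i _ => Lam_step hx0 i) (fun i hi => by
      have := Lam_step hy0 i
      rw [hy1 ⟨i, hi⟩, ← hx1 ⟨i, hi⟩] at this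
      exact this)).1
  simp only [Function.iterate_zero, id] at hc
  have hb : ∀ z ∈ Lam, K * n + (τ - 2) * (∑ i : Fin n, Real.log (w i + 1)) ≤
      Real.log (cfA (n + 1) z) → gaussMap^[n] z ≤
      Real.exp (-(K * n + (τ - 2) * (∑ i : Fin n, Real.log (w i + 1)))) := by
    intro z hz hz2
    have h1 : (1:ℝ) ≤ cfA (n + 1) z := by exact_mod_cast Lam_one_le hz n
    rw [Lam_step hz n, Real.exp_neg]
    apply inv_anti₀ (Real.exp_pos _)
    rw [Real.le_log_iff_exp_le (by linarith)] at hz2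
    linarith [(Lam_t hz (n + 1)).1]
  have hd : |gaussMap^[n] x - gaussMap^[n] y| ≤
      Real.exp (-(K * n + (τ - 2) * (∑ i : Fin n, Real.log (w i + 1)))) := by
    rw [abs_le]
    constructor <;> linarith [hb x hx0 hx2, hb y hy0 hy2, (Lam_t hx0 n).1, (Lam_t hy0 n).1]
  have hprod : (∏ i ∈ Finset.range n, (cfA (i + 1) x : ℝ)) =
      Real.exp (∑ i : Fin n, Real.log (w i + 1)) := by
    rw [Real.exp_sum, ← Fin.prod_univ_eq_prod_range (fun i => (cfA (i + 1) x : ℝ))]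
    apply Finset.prod_congr rfl
    intro i _
    rw [hx1 i, Real.exp_log (by positivity)]; push_cast; rfl
  have hprod2 : (∏ i : Fin n, ((w i : ℝ) + 1) ^ (-τ)) =
      Real.exp (-τ * ∑ i : Fin n, Real.log (w i + 1)) := by
    rw [Finset.mul_sum, Real.exp_sum]
    apply Finset.prod_congr rfl
    intro i _
    rw [Real.rpow_def_of_pos (by positivity), mul_comm]
  rw [hprod] at hc
  rw [hprod2]
  refine (hc.trans (mul_le_mul_of_nonneg_right hd (by positivity))).trans (le_of_eq ?_)
  rw [← Real.exp_neg, ← Real.exp_nat_mul, ← Real.exp_add, ← Real.exp_add]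
  congr 1
  push_cast
  ring

lemma tsum_words (f : ℕ → ℝ≥0∞) (n : ℕ) :
    ∑' w : Fin n → ℕ, ∏ i, f (w i) = (∑' a, f a) ^ n := by
  induction n with
  | zero => simp
  | succ n ih =>
    rw [← (Fin.consEquiv (fun _ => ℕ)).tsum_eq,
      ENNReal.tsum_prod (f := fun a b => ∏ i, f ((Fin.consEquiv fun _ => ℕ) (a, b) i))]
    simp only [Fin.consEquiv, Equiv.coe_fn_mk, Fin.prod_univ_succ, Fin.cons_zero, Fin.cons_succ]
    simp_rw [ENNReal.tsum_mul_left, ih, ENNReal.tsum_mul_right]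
    rw [pow_succ, mul_comm]

lemma dim_F (σ : NNReal) (τ : ℝ) (hσ : 0 < σ) (hτ0 : 0 < τ) (hτ : 1 < σ * τ) :
    ∃ K : ℝ, 0 < K ∧ dimH {x | x ∈ Lam ∧ ∃ᶠ n : ℕ in atTop,
      K * n + (τ - 2) * (∑ i ∈ Finset.range n, Real.log (cfA (i + 1) x)) ≤
        Real.log (cfA (n + 1) x)} ≤ σ := by
  have hσ' : (0:ℝ) < σ := hσ
  have hs : Summable (fun a : ℕ => ((a : ℝ) + 1) ^ (-(τ * σ))) := by
    have := (summable_nat_add_iff 1).2 (Real.summable_nat_rpow (p := -(τ * σ)) |>.2 (by linarith))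
    simpa using this
  set Z := ∑' a : ℕ, ((a : ℝ) + 1) ^ (-(τ * σ)) with hZ
  have hZ0 : 0 ≤ Z := tsum_nonneg fun a => by positivity
  set K := Real.log (2 * Z + 2) / σ with hK
  have hK0 : 0 < K := div_pos (Real.log_pos (by linarith)) hσ'
  refine ⟨K, hK0, ?_⟩
  set F := {x | x ∈ Lam ∧ ∃ᶠ n : ℕ in atTop,
      K * n + (τ - 2) * (∑ i ∈ Finset.range n, Real.log (cfA (i + 1) x)) ≤
        Real.log (cfA (n + 1) x)} with hF
  let f : ℕ → ℝ≥0∞ := fun a => ENNReal.ofReal (Real.exp (-K * σ) * ((a : ℝ) + 1) ^ (-(τ * σ)))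
  have hf : ∑' a, f a ≤ 2⁻¹ := by
    rw [← ENNReal.ofReal_tsum_of_nonneg (fun a => by positivity) (hs.mul_left _), tsum_mul_left,
      ← hZ]
    have : Real.exp (-K * σ) = (2 * Z + 2)⁻¹ := by
      rw [hK, neg_mul, div_mul_cancel₀ _ hσ'.ne', Real.exp_neg, Real.exp_log (by linarith)]
    rw [this, ← ENNReal.ofReal_ofNat, ← ENNReal.ofReal_inv_of_pos (by norm_num)]
    apply ENNReal.ofReal_le_ofReal
    rw [inv_mul_le_iff₀ (by linarith)]
    linarith
  have hdiam : ∀ p, Metric.ediam (Jset τ K p) ≤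
      ENNReal.ofReal (Real.exp (-K * p.1) * ∏ i : Fin p.1, ((p.2 i : ℝ) + 1) ^ (-τ)) := by
    intro p
    refine Metric.ediam_le fun x hx y hy => ?_
    rw [edist_dist, Real.dist_eq]
    exact ENNReal.ofReal_le_ofReal (Jset_dist hx hy)
  have hdiam2 : ∀ p, Metric.ediam (Jset τ K p) ^ (σ : ℝ) ≤ ∏ i : Fin p.1, f (p.2 i) := by
    intro p
    refine (ENNReal.rpow_le_rpow (hdiam p) hσ'.le).trans (le_of_eq ?_)
    rw [ENNReal.ofReal_rpow_of_nonneg (by positivity) hσ'.le,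
      ← ENNReal.ofReal_prod_of_nonneg (fun _ _ => by positivity)]
    congr 1
    rw [Real.mul_rpow (by positivity) (by positivity), Finset.prod_mul_distrib,
      Finset.prod_const, ← Real.finsetProd_rpow _ _ (fun _ _ => by positivity), ← Real.exp_mul,
      ← Real.exp_nat_mul]
    congr 1
    · congr 1; simp; ring
    · apply Finset.prod_congr rfl
      intro i _
      rw [← Real.rpow_mul (by positivity), neg_mul]
  have hmeas : μH[(σ : ℝ)] F ≤ liminf (fun N : ℕ => ∑' (i : Σ k : ℕ, (Fin (k + N) → ℕ)),
      Metric.ediam (Jset τ K ⟨i.1 + N, i.2⟩) ^ (σ : ℝ)) atTop := by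
    refine Measure.hausdorffMeasure_le_liminf_tsum (σ : ℝ) F
      (fun N : ℕ => ENNReal.ofReal (Real.exp (-K * N))) ?_ _ ?_ ?_
    · rw [← ENNReal.ofReal_zero]
      apply ENNReal.tendsto_ofReal
      apply Real.tendsto_exp_atBot.comp
      exact tendsto_natCast_atTop_atTop.const_mul_atTop_of_neg (by linarith)
    · refine Eventually.of_forall fun N i => (hdiam _).trans (ENNReal.ofReal_le_ofReal ?_)
      have h1 : ∏ j : Fin (i.1 + N), ((i.2 j : ℝ) + 1) ^ (-τ) ≤ 1 := by
        apply Finset.prod_le_one (fun _ _ => by positivity)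
        intro j _
        apply Real.rpow_le_one_of_one_le_of_nonpos (by simp) (by linarith)
      refine (mul_le_of_le_one_right (by positivity) h1).trans (Real.exp_le_exp.2 ?_)
      push_cast
      nlinarith [(Nat.cast_nonneg i.1 : (0:ℝ) ≤ i.1)]
    · refine Eventually.of_forall fun N x hx => ?_
      obtain ⟨hx0, hx1⟩ := hx
      obtain ⟨n, hn, hn2⟩ := (frequently_atTop.1 hx1) N
      obtain ⟨k, rfl⟩ : ∃ k, n = k + N := ⟨n - N, by omega⟩
      refine mem_iUnion.2 ⟨⟨k, fun i => cfA (i + 1) x - 1⟩, hx0, ?_, ?_⟩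
      · intro i
        have := Lam_one_le hx0 i
        simp only; omega
      · refine le_trans (le_of_eq ?_) hn2
        dsimp only
        rw [← Fin.sum_univ_eq_sum_range (fun i => Real.log (cfA (i + 1) x))]
        congr 2
        apply Finset.sum_congr rfl
        intro i _
        have := Lam_one_le hx0 i
        rw [Nat.cast_sub this]; simp
  have hlim : Tendsto (fun N : ℕ => ∑' k : ℕ, (2⁻¹ : ℝ≥0∞) ^ (k + N)) atTop (nhds 0) := by
    apply ENNReal.tendsto_sum_nat_add (fun k => (2⁻¹ : ℝ≥0∞) ^ k)
    rw [ENNReal.tsum_geometric]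
    simp
  have hle : liminf (fun N : ℕ => ∑' (i : Σ k : ℕ, (Fin (k + N) → ℕ)),
      Metric.ediam (Jset τ K ⟨i.1 + N, i.2⟩) ^ (σ : ℝ)) atTop ≤ 0 := by
    rw [← hlim.liminf_eq]
    refine Filter.liminf_le_liminf (Eventually.of_forall fun N => ?_)
    calc _ ≤ ∑' (i : Σ k : ℕ, (Fin (k + N) → ℕ)), ∏ j, f (i.2 j) :=
          ENNReal.tsum_le_tsum fun i => hdiam2 _
      _ = ∑' k : ℕ, ∑' w : Fin (k + N) → ℕ, ∏ j, f (w j) :=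
          ENNReal.tsum_sigma (fun (k : ℕ) (w : Fin (k + N) → ℕ) => ∏ j, f (w j))
      _ ≤ _ := by
        refine ENNReal.tsum_le_tsum fun k => ?_
        rw [tsum_words]
        gcongr
  apply dimH_le_of_hausdorffMeasure_ne_top
  exact ne_top_of_le_ne_top ENNReal.zero_ne_top (hmeas.trans hle)

lemma seq_upper (u ψ : ℕ → ℝ) (hu : Monotone u) (hu0 : ∀ n, 0 ≤ u n) (c c1 τ K : ℝ)
    (hc : 0 < c) (hcc : c < c1) (hτ : τ < c + 1) (hK : 0 < K)
    (hψ : Tendsto ψ atTop atTop) (hψ1 : ∀ᶠ n in atTop, c1 ^ n ≤ ψ n)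
    (hio : ∃ᶠ n in atTop, ψ (n + 1) / 2 ≤ u n) :
    ∃ᶠ n : ℕ in atTop, K * n + (τ - 2) * (∑ i ∈ Finset.range n, u i) ≤ u n := by
  by_contra hcon
  rw [not_frequently] at hcon
  have hu_inf : Tendsto u atTop atTop := by
    refine tendsto_atTop_atTop_of_monotone hu fun b => ?_
    have h1 : ∀ᶠ n in atTop, 2 * b ≤ ψ (n + 1) :=
      ((tendsto_add_atTop_iff_nat 1).2 hψ).eventually_ge_atTop _
    obtain ⟨n, hn1, hn2⟩ := (hio.and_eventually h1).exists
    exact ⟨n, by linarith⟩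
  set S : ℕ → ℝ := fun n => ∑ i ∈ Finset.range n, u i with hS
  have hS0 : ∀ n, 0 ≤ S n := fun n => Finset.sum_nonneg fun i _ => hu0 i
  have hSs : ∀ n, S (n + 1) = S n + u n := fun n => Finset.sum_range_succ _ _
  set ε := c + 1 - τ with hε
  have hε0 : 0 < ε := by linarith
  have hSK : ∀ᶠ n : ℕ in atTop, K * n ≤ ε * S n := by
    obtain ⟨N, hN⟩ := eventually_atTop.1 (hu_inf.eventually_ge_atTop (2 * K / ε))
    have h2 : ∀ m : ℕ, m * (2 * K / ε) ≤ S (N + m) := by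
      intro m
      induction m with
      | zero => simpa using hS0 N
      | succ m ih =>
        rw [← add_assoc, hSs]; push_cast
        linarith [hN (N + m) (by omega)]
    filter_upwards [eventually_ge_atTop (2 * N)] with n hn
    obtain ⟨m, rfl⟩ : ∃ m, n = N + m := ⟨n - N, by omega⟩
    have h3 := h2 m
    have h4 : (N : ℝ) ≤ m := by exact_mod_cast (by omega : N ≤ m)
    have h5 : ε * (m * (2 * K / ε)) = 2 * K * m := by field_simp
    have h6 := mul_le_mul_of_nonneg_left h3 hε0.le
    push_cast
    nlinarith
  obtain ⟨N, hN⟩ := eventually_atTop.1 (hcon.and hSK)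
  have hrec : ∀ m, S (N + m) ≤ S N * c ^ m := by
    intro m
    induction m with
    | zero => simp
    | succ m ih =>
      obtain ⟨h1, h2⟩ := hN (N + m) (by omega)
      push Not at h1
      have h3 : S (N + m + 1) ≤ c * S (N + m) := by
        rw [hSs]
        have : (τ - 2) * S (N + m) + ε * S (N + m) = (c - 1) * S (N + m) := by rw [hε]; ring
        have h1' : u (N + m) < K * ↑(N + m) + (τ - 2) * S (N + m) := h1
        linarith
      rw [← add_assoc, pow_succ]
      nlinarith
  have hc1 : 0 < c1 := by linarith
  have hz : Tendsto (fun m : ℕ => (2 * S N) * (c / c1) ^ m) atTop (nhds ((2 * S N) * 0)) :=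
    (tendsto_pow_atTop_nhds_zero_of_lt_one (by positivity) ((div_lt_one hc1).2 hcc)).const_mul _
  rw [mul_zero] at hz
  have hz2 := hz.eventually_lt_const (show (0:ℝ) < c1 ^ N by positivity)
  obtain ⟨M, hM⟩ := eventually_atTop.1 hz2
  obtain ⟨n, ⟨hn1, hn2⟩, hn3⟩ := ((hio.and_eventually
    ((tendsto_add_atTop_nat 1).eventually hψ1)).and_eventually
      (eventually_ge_atTop (N + M))).exists
  obtain ⟨m, hm⟩ : ∃ m, n + 1 = N + m := ⟨n + 1 - N, by omega⟩
  have h1 := hM m (by omega)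
  have h2 := hrec m
  rw [← hm] at h2
  have h3 : u n ≤ S (n + 1) := by rw [hSs]; linarith [hS0 n]
  have h4 : c1 ^ (n + 1) ≤ 2 * S N * c ^ m := by linarith
  rw [hm, pow_add] at h4
  rw [div_pow] at h1
  have h5 : 0 < c1 ^ m := by positivity
  have h6 : 2 * S N * c ^ m < c1 ^ N * c1 ^ m := by
    rw [← mul_div_assoc, div_lt_iff₀ h5] at h1
    exact h1
  linarith

lemma psi_atTop {ψ : ℕ → ℝ} 
    (hψ : Tendsto (fun n : ℕ => ψ n / Real.log n) atTop atTop) : Tendsto ψ atTop atTop := by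
  have h1 : Tendsto (fun n : ℕ => Real.log n) atTop atTop :=
    Real.tendsto_log_atTop.comp tendsto_natCast_atTop_atTop
  refine (hψ.atTop_mul_atTop₀ h1).congr' ?_
  filter_upwards [h1.eventually_gt_atTop 0] with n hn
  field_simp

lemma ev_pow {ψ : ℕ → ℝ} (hψpos : ∀ n, 0 < ψ n) {A : ℝ≥0∞}
    (hA : ENNReal.log A =
      Filter.liminf (fun n : ℕ => ((Real.log (ψ n) / n : ℝ) : EReal)) atTop) {c : ℝ} (hc : 0 < c)
    (hcA : ENNReal.ofReal c < A) : ∀ᶠ n in atTop, c ^ n ≤ ψ n := by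
  have h1 := ENNReal.log_lt_log_iff.2 hcA
  rw [hA, ENNReal.log_ofReal_of_pos hc] at h1
  filter_upwards [eventually_lt_of_lt_liminf h1, eventually_gt_atTop 0] with n hn hn0
  rw [EReal.coe_lt_coe_iff] at hn
  have hn0' : (0:ℝ) < n := by exact_mod_cast hn0
  rw [lt_div_iff₀ hn0'] at hn
  rw [← Real.log_le_log_iff (by positivity) (hψpos n), Real.log_pow]
  linarith

theorem upper (ψ : ℕ → ℝ) (hψpos : ∀ n, 0 < ψ n)
    (hψ : Tendsto (fun n : ℕ => ψ n / Real.log n) atTop atTop)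
    (A : ℝ≥0∞) (hA1 : 1 ≤ A)
    (hA : ENNReal.log A =
      Filter.liminf (fun n : ℕ => ((Real.log (ψ n) / n : ℝ) : EReal)) atTop) :
    dimH {x | x ∈ Lam ∧
        Filter.limsup (fun n : ℕ => ((Real.log (cfA n x) / ψ n : ℝ) : EReal)) atTop =
          (1 : EReal)} ≤ (A + 1)⁻¹ := by
  refine le_of_forall_gt_imp_ge_of_dense fun d hd => ?_
  obtain ⟨σ, hσ1, hσ2⟩ := ENNReal.lt_iff_exists_nnreal_btwn.1 hd
  refine le_trans ?_ hσ2.le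
  have hσ0 : 0 < σ := by
    have := (zero_le).trans_lt hσ1
    exact_mod_cast this
  have hσ' : (0:ℝ) < σ := hσ0
  -- choose c, c1
  obtain ⟨c, c1, hc, hcc, hc1A, hcσ⟩ : ∃ c c1 : ℝ, 0 < c ∧ c < c1 ∧ ENNReal.ofReal c1 < A ∧
      1 < σ * (c + 1) := by
    have hcont : ∀ a : ℝ, 1 ≤ a → (a + 1)⁻¹ < σ → ∃ c c1 : ℝ, 0 < c ∧ c < c1 ∧ c1 < a ∧
      1 < σ * (c + 1) := by
      intro a ha has
      have h1 : 1 < σ * (a + 1) := by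
        rw [inv_lt_iff_one_lt_mul₀ (by linarith)] at has; linarith
      have h2 : 1 / (σ:ℝ) - 1 < a := by
        rw [sub_lt_iff_lt_add, div_lt_iff₀ hσ']; linarith
      obtain ⟨c, hc1, hc2⟩ := exists_between (max_lt h2 (show (0:ℝ) < a by linarith))
      obtain ⟨c1, hc3, hc4⟩ := exists_between hc2
      have h3 := (le_max_left _ _).trans_lt hc1
      refine ⟨c, c1, (le_max_right _ _).trans_lt hc1, hc3, hc4, ?_⟩
      rw [sub_lt_iff_lt_add, div_lt_iff₀ hσ'] at h3; linarith
    rcases eq_or_ne A ⊤ with rfl | hAtop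
    · obtain ⟨c, c1, h1, h2, -, h4⟩ := hcont (max 1 (1 / σ)) (le_max_left _ _) (by
        rw [inv_lt_iff_one_lt_mul₀ (by positivity)]
        have := le_max_right 1 (1 / (σ:ℝ))
        rw [div_le_iff₀ hσ'] at this
        nlinarith)
      exact ⟨c, c1, h1, h2, ENNReal.ofReal_lt_top, h4⟩
    · lift A to NNReal using hAtop
      obtain ⟨c, c1, h1, h2, h3, h4⟩ := hcont A (by exact_mod_cast hA1) (by
        have : ((A : ℝ≥0∞) + 1)⁻¹ = ((A + 1)⁻¹ : NNReal) := by
          rw [ENNReal.coe_inv (by positivity)]; simp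
        rw [this] at hσ1
        exact_mod_cast hσ1)
      refine ⟨c, c1, h1, h2, ?_, h4⟩
      rw [ENNReal.ofReal_lt_coe_iff] 
      · exact h3
      · linarith
  obtain ⟨τ, hτ1, hτ2⟩ := exists_between (show 1 / (σ:ℝ) < c + 1 by
    rw [div_lt_iff₀ hσ']; linarith)
  have hτ0 : 0 < τ := lt_trans (by positivity) hτ1
  obtain ⟨K, hK, hdim⟩ := dim_F σ τ hσ0 hτ0 (by
    rw [div_lt_iff₀ hσ'] at hτ1; linarith)
  refine (dimH_mono ?_).trans hdim
  rintro x ⟨hx, hlim⟩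
  refine ⟨hx, ?_⟩
  refine seq_upper (fun n => Real.log (cfA (n + 1) x)) ψ ?_ ?_ c c1 τ K hc hcc hτ2 hK
    (psi_atTop hψ) (ev_pow hψpos hA (hc.trans hcc) hc1A) ?_
  · intro m n hmn
    apply Real.log_le_log
    · exact_mod_cast Lam_one_le hx m
    · exact_mod_cast Lam_mono hx hmn
  · intro n; positivity
  · have h1 : ∃ᶠ n : ℕ in atTop, ((2⁻¹ : ℝ) : EReal) < ((Real.log (cfA n x) / ψ n : ℝ) : EReal) := by
      apply frequently_lt_of_lt_limsup
      · isBoundedDefault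
      · rw [hlim]; exact_mod_cast (by norm_num : (2⁻¹:ℝ) < 1)
    rw [frequently_atTop] at h1 ⊢
    intro N
    obtain ⟨n, hn, hn2⟩ := h1 (N + 1)
    obtain ⟨m, rfl⟩ : ∃ m, n = m + 1 := ⟨n - 1, by omega⟩
    refine ⟨m, by omega, ?_⟩
    rw [EReal.coe_lt_coe_iff, lt_div_iff₀ (hψpos _)] at hn2
    linarith

lemma cf_exists_fin (N : ℕ) : ∀ (a : ℕ → ℕ), (∀ i, 2 ≤ a i) → ∃ t : ℕ → ℝ,
    (∀ i, 0 ≤ t i ∧ t i ≤ 1) ∧ ∀ i < N, t i * (a i + t (i + 1)) = 1 := by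
  induction N with
  | zero => exact fun a _ => ⟨fun _ => 0, by simp, by simp⟩
  | succ N ih =>
    intro a ha
    obtain ⟨t, ht, h⟩ := ih (fun i => a (i + 1)) (fun i => ha _)
    have h2 : (2:ℝ) ≤ a 0 := by exact_mod_cast ha 0
    have h3 : (1:ℝ) ≤ a 0 + t 0 := by linarith [(ht 0).1]
    refine ⟨fun i => Nat.casesOn i ((a 0 + t 0)⁻¹) t, ?_, ?_⟩
    · rintro (_ | i)
      · exact ⟨inv_nonneg.2 (by linarith), inv_le_one_of_one_le₀ h3⟩
      · exact ht i
    · rintro (_ | i) hi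
      · exact inv_mul_cancel₀ (by linarith)
      · exact h i (by omega)

lemma cf_exists (a : ℕ → ℕ) (ha : ∀ i, 2 ≤ a i) : ∃ t : ℕ → ℝ,
    (∀ i, 0 ≤ t i ∧ t i ≤ 1) ∧ ∀ i, t i * (a i + t (i + 1)) = 1 := by
  let T : ℕ → Set (ℕ → ℝ) := fun N => (Set.pi univ fun _ => Icc (0:ℝ) 1) ∩
    ⋂ i : ℕ, ⋂ _ : i < N, {t : ℕ → ℝ | t i * (a i + t (i + 1)) = 1}
  have hcl : ∀ N, IsClosed (⋂ i : ℕ, ⋂ _ : i < N, {t : ℕ → ℝ | t i * (a i + t (i + 1)) = 1}) := by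
    intro N
    refine isClosed_iInter fun i => isClosed_iInter fun _ => ?_
    exact isClosed_eq (by fun_prop) continuous_const
  have hK : IsCompact (Set.pi univ fun _ : ℕ => Icc (0:ℝ) 1) :=
    isCompact_univ_pi fun _ => isCompact_Icc
  obtain ⟨t, ht⟩ := IsCompact.nonempty_iInter_of_sequence_nonempty_isCompact_isClosed T
    (by
      rintro N t ⟨h1, h2⟩
      refine ⟨h1, ?_⟩
      simp only [mem_iInter] at h2 ⊢
      exact fun i hi => h2 i (by omega))
    (by
      intro N
      obtain ⟨t, h1, h2⟩ := cf_exists_fin N a ha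
      refine ⟨t, fun i _ => h1 i, ?_⟩
      simp only [mem_iInter]
      exact h2)
    (hK.inter_right (hcl 0))
    (fun N => hK.isClosed.inter (hcl N))
  rw [mem_iInter] at ht
  refine ⟨t, fun i => (ht 0).1 i trivial, fun i => ?_⟩
  have := (ht (i + 1)).2
  simp only [mem_iInter] at this
  exact this i (by omega)

lemma cf_digits (a : ℕ → ℕ) (ha : ∀ i, 2 ≤ a i) (t : ℕ → ℝ)
    (ht : ∀ i, 0 ≤ t i ∧ t i ≤ 1) (h : ∀ i, t i * (a i + t (i + 1)) = 1) :
    (∀ i, 0 < t i ∧ t i ≤ 1 / 2) ∧ ∀ i, cfA (i + 1) (t 0) = a i := by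
  have h2 : ∀ i, (2:ℝ) ≤ a i := fun i => by exact_mod_cast ha i
  have h0 : ∀ i, 0 < t i ∧ t i ≤ 1 / 2 := by
    intro i
    have h3 := h i
    have h4 := h2 i
    have h5 := (ht (i + 1)).1
    have h6 := (ht i).1
    constructor
    · rcases h6.lt_or_eq with h | h
      · exact h
      · rw [← h] at h3; simp at h3
    · nlinarith
  have hinv : ∀ i, (t i)⁻¹ = a i + t (i + 1) := fun i => inv_eq_of_mul_eq_one_right (h i)
  have hg : ∀ i, gaussMap^[i] (t 0) = t i := by
    intro i
    induction i with
    | zero => rfl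
    | succ i ih =>
      rw [Function.iterate_succ_apply', ih, gaussMap, hinv, Int.fract_natCast_add,
        Int.fract_eq_self]
      exact ⟨(ht _).1, by linarith [(h0 (i + 1)).2]⟩
  refine ⟨h0, fun i => ?_⟩
  rw [cfA, Nat.add_sub_cancel, hg, hinv, Nat.floor_eq_iff (by linarith [h2 i, (ht (i + 1)).1])]
  exact ⟨by linarith [(ht (i + 1)).1], by linarith [(h0 (i + 1)).2]⟩

/-- Remainders of the mixed radix expansion. -/
noncomputable def rem (s : ℕ → ℕ) (y : ℝ) : ℕ → ℝ
  | 0 => y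
  | i + 1 => Int.fract (s i * rem s y i)

/-- Digits of the mixed radix expansion. -/
noncomputable def dig (s : ℕ → ℕ) (y : ℝ) (i : ℕ) : ℕ := ⌊s i * rem s y i⌋₊

lemma rem_mem (s : ℕ → ℕ) {y : ℝ} (hy : y ∈ Ico (0:ℝ) 1) (i : ℕ) : rem s y i ∈ Ico (0:ℝ) 1 := by
  cases i with
  | zero => exact hy
  | succ i => exact ⟨Int.fract_nonneg _, Int.fract_lt_one _⟩

lemma rem_succ (s : ℕ → ℕ) {y : ℝ} (hy : y ∈ Ico (0:ℝ) 1) (i : ℕ) :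
    s i * rem s y i = dig s y i + rem s y (i + 1) := by
  have := (rem_mem s hy i).1
  rw [dig, rem, natCast_floor_eq_intCast_floor (by positivity), Int.floor_add_fract]

lemma dig_lt (s : ℕ → ℕ) (hs : ∀ i, 2 ≤ s i) {y : ℝ} (hy : y ∈ Ico (0:ℝ) 1) (i : ℕ) :
    dig s y i < s i := by
  have h := rem_mem s hy i
  have h2 : (2:ℝ) ≤ s i := by exact_mod_cast hs i
  rw [dig, Nat.floor_lt (by have := h.1; positivity)]
  nlinarith [h.2]

lemma dig_diff (s : ℕ → ℕ) {y y' : ℝ} (hy : y ∈ Ico (0:ℝ) 1) (hy' : y' ∈ Ico (0:ℝ) 1) (n : ℕ)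
    (h : ∀ i < n, dig s y i = dig s y' i) :
    |y - y'| * ∏ i ∈ Finset.range n, (s i : ℝ) = |rem s y n - rem s y' n| := by
  induction n with
  | zero => simp [rem]
  | succ n ih =>
    rw [Finset.prod_range_succ, ← mul_assoc, ih (fun i hi => h i (by omega))]
    have e1 := rem_succ s hy n
    have e2 := rem_succ s hy' n
    rw [h n (by omega)] at e1
    have : rem s y (n + 1) - rem s y' (n + 1) = (rem s y n - rem s y' n) * s n := by linarith
    rw [this, abs_mul, Nat.abs_cast]

lemma two_pow_le_prod (s : ℕ → ℕ) (hs : ∀ i, 2 ≤ s i) (n : ℕ) :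
    (2:ℝ) ^ n ≤ ∏ i ∈ Finset.range n, (s i : ℝ) := by
  have := Finset.prod_le_prod (s := Finset.range n) (f := fun _ => (2:ℝ)) (g := fun i => (s i : ℝ))
    (fun _ _ => by norm_num) (fun i _ => by exact_mod_cast hs i)
  simpa using this

lemma dig_inj (s : ℕ → ℕ) (hs : ∀ i, 2 ≤ s i) {y y' : ℝ} (hy : y ∈ Ico (0:ℝ) 1)
    (hy' : y' ∈ Ico (0:ℝ) 1) (h : ∀ i, dig s y i = dig s y' i) : y = y' := by
  by_contra hne
  have hpos : 0 < |y - y'| := abs_pos.2 (sub_ne_zero.2 hne)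
  obtain ⟨n, hn⟩ := pow_unbounded_of_one_lt (1 / |y - y'|) (one_lt_two : (1:ℝ) < 2)
  have h1 := dig_diff s hy hy' n (fun i _ => h i)
  have h2 : |rem s y n - rem s y' n| ≤ 1 := by
    have a1 := rem_mem s hy n
    have a2 := rem_mem s hy' n
    rw [abs_le]; constructor <;> linarith [a1.1, a1.2, a2.1, a2.2]
  have h3 := two_pow_le_prod s hs n
  rw [div_lt_iff₀ hpos] at hn
  nlinarith

lemma lower_core (s : ℕ → ℕ) (hs : ∀ i, 2 ≤ s i) (hmono : Monotone s) (σ : NNReal) (hσ : 0 < σ)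
    (hσ1 : σ ≤ 1) (C : ℝ) (hC : ∀ n : ℕ, 4 * (∏ i ∈ Finset.range (n + 1), ((i : ℝ) + 2)) ^ (2 * σ : ℝ)
      * (∏ i ∈ Finset.range (n + 1), (s i : ℝ)) ^ (2 * σ : ℝ) * (s n : ℝ) ^ (1 - σ : ℝ)
      ≤ C * ∏ i ∈ Finset.range (n + 1), (s i : ℝ)) (E : Set ℝ)
    (hE : ∀ x ∈ Lam, (∀ i, (i + 1) * s i ≤ cfA (i + 1) x ∧ cfA (i + 1) x + 1 ≤ (i + 2) * s i) →
      x ∈ E) : (σ : ℝ≥0∞) ≤ dimH E := by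
  have hσ' : (0:ℝ) < σ := hσ
  have hσ1' : (σ:ℝ) ≤ 1 := hσ1
  let a : ℝ → ℕ → ℕ := fun y i => (i + 1) * s i + dig s y i
  have ha2 : ∀ y i, 2 ≤ a y i := by
    intro y i
    have := hs i
    simp only [a]; nlinarith
  have hex : ∀ y, ∃ t : ℕ → ℝ, (∀ i, 0 ≤ t i ∧ t i ≤ 1) ∧ ∀ i, t i * (a y i + t (i + 1)) = 1 :=
    fun y => cf_exists (a y) (ha2 y)
  choose t ht1 ht2 using hex
  have hcf := fun y => cf_digits (a y) (ha2 y) (t y) (ht1 y) (ht2 y)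
  have hub : ∀ y ∈ Ico (0:ℝ) 1, ∀ i, a y i + 1 ≤ (i + 2) * s i := by
    intro y hy i
    have := dig_lt s hs hy i
    simp only [a]; nlinarith
  have hmem : ∀ y ∈ Ico (0:ℝ) 1, t y 0 ∈ E := by
    intro y hy
    obtain ⟨h1, h2⟩ := hcf y
    apply hE
    · refine ⟨⟨(h1 0).1, by linarith [(h1 0).2]⟩, fun n hn => ?_⟩
      obtain ⟨m, rfl⟩ : ∃ m, n = m + 1 := ⟨n - 1, by omega⟩
      rw [h2, h2]
      have e1 := hub y hy m
      have e2 : (m + 1 + 1) * s m ≤ (m + 1 + 1) * s (m + 1) :=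
        Nat.mul_le_mul_left _ (hmono (by omega))
      have e3 : a y (m + 1) = (m + 1 + 1) * s (m + 1) + dig s y (m + 1) := rfl
      have e4 : (m + 2) * s m = (m + 1 + 1) * s m := rfl
      omega
    · intro i
      rw [h2]
      exact ⟨Nat.le_add_right _ _, hub y hy i⟩
  -- key estimate
  have key : ∀ y ∈ Ico (0:ℝ) 1, ∀ y' ∈ Ico (0:ℝ) 1,
      |y - y'| ≤ C * |t y 0 - t y' 0| ^ (σ : ℝ) := by
    intro y hy y' hy'
    by_cases hall : ∀ i, dig s y i = dig s y' i
    · rw [dig_inj s hs hy hy' hall]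
      simp [hσ'.ne']
    push Not at hall
    classical
    set n := Nat.find hall with hn
    have hne : dig s y n ≠ dig s y' n := Nat.find_spec hall
    have heq : ∀ i < n, dig s y i = dig s y' i := fun i hi => by
      simpa using Nat.find_min hall hi
    set M : ℝ := |(dig s y n : ℝ) - dig s y' n| with hM
    have hM1 : 1 ≤ M := by
      have : (1:ℤ) ≤ |(dig s y n : ℤ) - dig s y' n| := Int.one_le_abs (by omega)
      rw [hM]
      have h2 : ((1:ℤ):ℝ) ≤ ((|(dig s y n : ℤ) - dig s y' n| : ℤ) : ℝ) := Int.cast_le.2 this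
      push_cast at h2
      exact h2
    have hMs : M ≤ s n := by
      have h1 : (dig s y n : ℝ) < s n := by exact_mod_cast dig_lt s hs hy n
      have h2 : (dig s y' n : ℝ) < s n := by exact_mod_cast dig_lt s hs hy' n
      rw [hM, abs_le]
      constructor <;> linarith [(Nat.cast_nonneg (dig s y n) : (0:ℝ) ≤ _),
        (Nat.cast_nonneg (dig s y' n) : (0:ℝ) ≤ _)]
    have hsn : (2:ℝ) ≤ s n := by exact_mod_cast hs n
    set P := ∏ i ∈ Finset.range (n + 1), (s i : ℝ) with hP
    set Q := ∏ i ∈ Finset.range (n + 1), ((i : ℝ) + 2) with hQ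
    have hP0 : 0 < P := lt_of_lt_of_le (by positivity) (two_pow_le_prod s hs (n + 1))
    have hQ0 : 0 < Q := Finset.prod_pos fun i _ => by positivity
    -- y side
    have hyP : |y - y'| * P ≤ 2 * M := by
      have h1 := dig_diff s hy hy' n heq
      rw [hP, Finset.prod_range_succ, ← mul_assoc, h1]
      have e1 := rem_succ s hy n
      have e2 := rem_succ s hy' n
      have a1 := rem_mem s hy (n + 1)
      have a2 := rem_mem s hy' (n + 1)
      have h2 : (rem s y n - rem s y' n) * s n = ((dig s y n : ℝ) - dig s y' n) +
        (rem s y (n + 1) - rem s y' (n + 1)) := by linarith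
      have h3 : |rem s y (n + 1) - rem s y' (n + 1)| ≤ 1 := by
        rw [abs_le]; constructor <;> linarith [a1.1, a1.2, a2.1, a2.2]
      calc |rem s y n - rem s y' n| * s n = |(rem s y n - rem s y' n) * s n| := by
            rw [abs_mul, Nat.abs_cast]
        _ ≤ M + |rem s y (n + 1) - rem s y' (n + 1)| := by rw [h2]; exact abs_add_le _ _
        _ ≤ 2 * M := by linarith
    -- x side
    have hxP : M / 2 * ((Q * P) ^ 2)⁻¹ ≤ |t y 0 - t y' 0| := by
      have hinv : ∀ y i, t y i = (a y i + t y (i + 1))⁻¹ := fun y i =>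
        eq_inv_of_mul_eq_one_left (ht2 y i)
      have h1 := (cf_diff (t y) (t y') (fun i => (a y i : ℝ)) n
        (fun i _ => by exact_mod_cast (by norm_num : 1 ≤ 2).trans (ha2 y i)) (ht1 y) (ht1 y')
        (fun i _ => hinv y i) (fun i hi => by
          rw [hinv y' i]
          simp only [a, heq i hi])).2
      refine le_trans ?_ h1
      have h2 : ∏ i ∈ Finset.range n, ((a y i : ℝ) + 1) ≤
          ∏ i ∈ Finset.range n, (((i : ℝ) + 2) * s i) := by
        apply Finset.prod_le_prod
        · intro i _; positivity
        · intro i _; exact_mod_cast hub y hy i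
      have h3 : M / 2 * (((n + 2) * s n : ℝ)⁻¹) ^ 2 ≤ |t y n - t y' n| := by
        have hd : t y n - t y' n = - ((((a y n : ℝ) + t y (n + 1)) - (a y' n + t y' (n + 1))) *
            (t y n * t y' n)) := by
          have e1 := ht2 y n
          have e2 := ht2 y' n
          linear_combination t y' n * e1 - t y n * e2
        rw [hd, abs_neg, abs_mul]
        have hb : ∀ y ∈ Ico (0:ℝ) 1, ((n + 2) * s n : ℝ)⁻¹ ≤ t y n := by
          intro y hy
          rw [hinv y n]
          have e1 : ((a y n : ℝ) + 1) ≤ (n + 2) * s n := by exact_mod_cast hub y hy n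
          have e2 : (2:ℝ) ≤ a y n := by exact_mod_cast ha2 y n
          apply inv_anti₀ <;> linarith [(ht1 y (n + 1)).1, (ht1 y (n + 1)).2]
        have hb1 := hb y hy
        have hb2 := hb y' hy'
        have hpos : (0:ℝ) < ((n + 2) * s n : ℝ)⁻¹ := by positivity
        have hh : M / 2 ≤ |((a y n : ℝ) + t y (n + 1)) - (a y' n + t y' (n + 1))| := by
          have e1 : ((a y n : ℝ) + t y (n + 1)) - (a y' n + t y' (n + 1)) =
            ((dig s y n : ℝ) - dig s y' n) - (t y' (n + 1) - t y (n + 1)) := by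
            simp only [a]; push_cast; ring
          have e2 : |t y' (n + 1) - t y (n + 1)| ≤ 1 / 2 := by
            have f1 := (hcf y).1 (n + 1)
            have f2 := (hcf y').1 (n + 1)
            rw [abs_le]; constructor <;> linarith [f1.1, f1.2, f2.1, f2.2]
          rw [e1]
          have := abs_sub_abs_le_abs_sub ((dig s y n : ℝ) - dig s y' n)
            (t y' (n + 1) - t y (n + 1))
          linarith
        rw [abs_of_pos (a := t y n * t y' n) (mul_pos (hpos.trans_le hb1) (hpos.trans_le hb2)), sq]
        have hy0 := hpos.trans_le hb1
        gcongr
      have h4 : Q * P = (∏ i ∈ Finset.range n, (((i : ℝ) + 2) * s i)) * ((n + 2) * s n) := by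
        rw [hQ, hP, ← Finset.prod_mul_distrib, Finset.prod_range_succ]
      have h5 : 0 < ∏ i ∈ Finset.range n, ((a y i : ℝ) + 1) :=
        Finset.prod_pos fun i _ => by positivity
      rw [h4, ← inv_pow, mul_inv, mul_pow]
      calc _ = (M / 2 * (((n + 2) * s n : ℝ)⁻¹) ^ 2) *
            ((∏ i ∈ Finset.range n, (((i : ℝ) + 2) * s i))⁻¹) ^ 2 := by ring
        _ ≤ _ := by gcongr
    -- combine
    have hC0 : 0 ≤ C := by
      have h1 := hC n
      by_contra hneg
      push Not at hneg
      have h2 : C * P < 0 := mul_neg_of_neg_of_pos hneg hP0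
      have h3 : 0 ≤ 4 * Q ^ (2 * σ : ℝ) * P ^ (2 * σ : ℝ) * (s n : ℝ) ^ (1 - σ : ℝ) := by positivity
      linarith
    have hfin : 2 * M ≤ C * (M / 2 * ((Q * P) ^ 2)⁻¹) ^ (σ : ℝ) * P := by
      have hM0 : 0 < M := by linarith
      have e1 : (M / 2 * ((Q * P) ^ 2)⁻¹) ^ (σ : ℝ) =
          M ^ (σ : ℝ) / (2 ^ (σ : ℝ) * (Q ^ (2 * σ : ℝ) * P ^ (2 * σ : ℝ))) := by
        rw [Real.mul_rpow (by positivity) (by positivity), Real.div_rpow hM0.le (by norm_num),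
          Real.inv_rpow (by positivity), ← Real.rpow_natCast, ← Real.rpow_mul (by positivity),
          Real.mul_rpow hQ0.le hP0.le]
        push_cast
        field_simp
      have e2 : M = M ^ (σ : ℝ) * M ^ (1 - σ : ℝ) := by
        rw [← Real.rpow_add hM0]; simp
      have e3 : M ^ (1 - σ : ℝ) ≤ (s n : ℝ) ^ (1 - σ : ℝ) :=
        Real.rpow_le_rpow hM0.le hMs (by linarith)
      have e4 : (2:ℝ) ^ (σ : ℝ) ≤ 2 := by
        calc (2:ℝ) ^ (σ : ℝ) ≤ 2 ^ (1:ℝ) := Real.rpow_le_rpow_of_exponent_le (by norm_num) hσ1'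
          _ = 2 := by simp
      have hX : 0 < Q ^ (2 * σ : ℝ) * P ^ (2 * σ : ℝ) := by positivity
      set X := Q ^ (2 * σ : ℝ) * P ^ (2 * σ : ℝ) with hXdef
      have hCn : 4 * X * (s n : ℝ) ^ (1 - σ : ℝ) ≤ C * P := by
        have := hC n
        rw [hXdef]; linarith
      have hD : 0 < (2:ℝ) ^ (σ : ℝ) * X := by positivity
      rw [e1, mul_assoc, div_mul_eq_mul_div, mul_div_assoc', le_div_iff₀ hD]
      calc 2 * M * (2 ^ (σ : ℝ) * X) ≤ 2 * M * (2 * X) := by gcongr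
        _ = M ^ (σ : ℝ) * (4 * X * M ^ (1 - σ : ℝ)) := by nth_rewrite 1 [e2]; ring
        _ ≤ M ^ (σ : ℝ) * (4 * X * (s n : ℝ) ^ (1 - σ : ℝ)) := by gcongr
        _ ≤ M ^ (σ : ℝ) * (C * P) := by gcongr
        _ = _ := by ring
    have hfin2 : |y - y'| * P ≤ C * |t y 0 - t y' 0| ^ (σ : ℝ) * P := by
      refine hyP.trans (hfin.trans ?_)
      gcongr
    exact le_of_mul_le_mul_right hfin2 hP0
  -- Hölder map
  set g : ℝ → ℝ := fun y => t y 0 with hg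
  have hinj : InjOn g (Ico (0:ℝ) 1) := by
    intro y hy y' hy' h
    have h1 := key y hy y' hy'
    have h2 : t y 0 = t y' 0 := h
    rw [h2, sub_self, abs_zero, Real.zero_rpow hσ'.ne', mul_zero] at h1
    exact sub_eq_zero.1 (abs_eq_zero.1 (le_antisymm h1 (abs_nonneg _)))
  set f := Function.invFunOn g (Ico (0:ℝ) 1) with hf
  have hfg : ∀ y ∈ Ico (0:ℝ) 1, f (g y) = y := fun y hy => hinj.leftInvOn_invFunOn hy
  have hhol : HolderOnWith C.toNNReal σ f (g '' Ico (0:ℝ) 1) := by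
    rintro _ ⟨y, hy, rfl⟩ _ ⟨y', hy', rfl⟩
    rw [hfg y hy, hfg y' hy', edist_dist, edist_dist, Real.dist_eq, Real.dist_eq,
      ENNReal.ofReal_rpow_of_nonneg (abs_nonneg _) hσ'.le]
    change _ ≤ ENNReal.ofReal C * _
    rw [← ENNReal.ofReal_mul' (by positivity)]
    exact ENNReal.ofReal_le_ofReal (key y hy y' hy')
  have h1 := hhol.dimH_image_le hσ
  have h2 : f '' (g '' Ico (0:ℝ) 1) = Ico (0:ℝ) 1 := by
    rw [image_image]
    ext z; constructor
    · rintro ⟨y, hy, rfl⟩; simpa only [hfg y hy] using hy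
    · intro hz; exact ⟨z, hz, hfg z hz⟩
  rw [h2, Real.dimH_of_nonempty_interior (by rw [interior_Ico]; exact ⟨1 / 2, by norm_num⟩)] at h1
  simp only [Module.finrank_self, Nat.cast_one] at h1
  rw [ENNReal.le_div_iff_mul_le (by left; exact_mod_cast hσ.ne') (by left; simp), one_mul] at h1
  refine h1.trans (dimH_mono ?_)
  rintro _ ⟨y, hy, rfl⟩
  exact hmem y hy

/-- Running infimum of the tail. -/
noncomputable def phi (ψ : ℕ → ℝ) (n : ℕ) : ℝ := ⨅ m : ℕ, ψ (n + 1 + m)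

/-- The partial sums of the greedy sequence. -/
noncomputable def Sseq (ψ : ℕ → ℝ) (B : ℝ) : ℕ → ℝ
  | 0 => 1
  | n + 1 => Sseq ψ B n + min (phi ψ n) ((B - 1) * Sseq ψ B n)

/-- The greedy sequence. -/
noncomputable def lseq (ψ : ℕ → ℝ) (B : ℝ) (n : ℕ) : ℝ :=
  min (phi ψ n) ((B - 1) * Sseq ψ B n)


lemma phi_le {ψ : ℕ → ℝ} (hψpos : ∀ n, 0 < ψ n) (n m : ℕ) : phi ψ n ≤ ψ (n + 1 + m) :=
  ciInf_le ⟨0, by rintro _ ⟨m, rfl⟩; exact (hψpos _).le⟩ m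

lemma phi_attained {ψ : ℕ → ℝ} (hψ : Tendsto ψ atTop atTop) (n : ℕ) :
    ∃ m, phi ψ n = ψ (n + 1 + m) := by
  have h1 : Tendsto (fun m => ψ (n + 1 + m)) cofinite atTop := by
    rw [Nat.cofinite_eq_atTop]
    exact hψ.comp (tendsto_atTop_mono (fun m => (by omega : m ≤ n + 1 + m)) tendsto_id)
  obtain ⟨m, hm⟩ := h1.exists_forall_le
  refine ⟨m, le_antisymm (ciInf_le ⟨ψ (n + 1 + m), ?_⟩ m) (le_ciInf hm)⟩
  rintro _ ⟨k, rfl⟩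
  exact hm k

lemma phi_mono {ψ : ℕ → ℝ} (hψpos : ∀ n, 0 < ψ n) : Monotone (phi ψ) := by
  refine monotone_nat_of_le_succ fun n => le_ciInf fun m => ?_
  have := phi_le hψpos n (m + 1)
  rwa [show n + 1 + (m + 1) = n + 1 + 1 + m by omega] at this

lemma Sseq_succ (ψ : ℕ → ℝ) (B : ℝ) (n : ℕ) : Sseq ψ B (n + 1) = Sseq ψ B n + lseq ψ B n := rfl

lemma phi_pos {ψ : ℕ → ℝ} (hψpos : ∀ n, 0 < ψ n) (hψ : Tendsto ψ atTop atTop) (n : ℕ) :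
    0 < phi ψ n := by
  obtain ⟨m, hm⟩ := phi_attained hψ n
  rw [hm]; exact hψpos _

lemma Sseq_pos {ψ : ℕ → ℝ} (hψpos : ∀ n, 0 < ψ n) (hψ : Tendsto ψ atTop atTop) {B : ℝ}
    (hB : 1 < B) (n : ℕ) : 0 < Sseq ψ B n := by
  induction n with
  | zero => simp [Sseq]
  | succ n ih =>
    rw [Sseq]
    have : 0 < min (phi ψ n) ((B - 1) * Sseq ψ B n) :=
      lt_min (phi_pos hψpos hψ n) (mul_pos (by linarith) ih)
    linarith

lemma lseq_pos {ψ : ℕ → ℝ} (hψpos : ∀ n, 0 < ψ n) (hψ : Tendsto ψ atTop atTop) {B : ℝ}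
    (hB : 1 < B) (n : ℕ) : 0 < lseq ψ B n :=
  lt_min (phi_pos hψpos hψ n) (mul_pos (by linarith) (Sseq_pos hψpos hψ hB n))

lemma lseq_mono {ψ : ℕ → ℝ} (hψpos : ∀ n, 0 < ψ n) (hψ : Tendsto ψ atTop atTop) {B : ℝ}
    (hB : 1 < B) : Monotone (lseq ψ B) := by
  refine monotone_nat_of_le_succ fun n => min_le_min (phi_mono hψpos (by omega)) ?_
  rw [Sseq_succ]
  have := lseq_pos hψpos hψ hB n
  apply mul_le_mul_of_nonneg_left <;> linarith

lemma lseq_le {ψ : ℕ → ℝ} (hψpos : ∀ n, 0 < ψ n) (B : ℝ) (n : ℕ) : lseq ψ B n ≤ ψ (n + 1) :=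
  (min_le_left _ _).trans (phi_le hψpos n 0)

lemma lseq_freq {ψ : ℕ → ℝ} (hψpos : ∀ n, 0 < ψ n) (hψ : Tendsto ψ atTop atTop) {B : ℝ}
    (hB : 1 < B) {A : ℝ≥0∞} (hAB : A < ENNReal.ofReal B)
    (hA : ENNReal.log A =
      Filter.liminf (fun n : ℕ => ((Real.log (ψ n) / n : ℝ) : EReal)) atTop) :
    ∃ᶠ n in atTop, lseq ψ B n = ψ (n + 1) := by
  by_contra hcon
  rw [not_frequently] at hcon
  obtain ⟨N, hN⟩ := eventually_atTop.1 hcon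
  have hlt : ∀ n ≥ N, lseq ψ B n < ψ (n + 1) := fun n hn =>
    lt_of_le_of_ne (lseq_le hψpos B n) (hN n hn)
  have hl : ∀ n ≥ N, lseq ψ B n = (B - 1) * Sseq ψ B n := by
    intro n hn
    obtain ⟨m, hm⟩ := phi_attained hψ n
    have h1 : lseq ψ B n < phi ψ n := by
      rw [hm]
      calc lseq ψ B n ≤ lseq ψ B (n + m) := lseq_mono hψpos hψ hB (by omega)
        _ < ψ (n + m + 1) := hlt _ (by omega)
        _ = _ := by congr 1; omega
    rcases min_choice (phi ψ n) ((B - 1) * Sseq ψ B n) with h | h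
    · exact absurd h h1.ne
    · exact h
  have hS : ∀ m, Sseq ψ B (N + m) = Sseq ψ B N * B ^ m := by
    intro m
    induction m with
    | zero => simp
    | succ m ih =>
      rw [← add_assoc, Sseq_succ, hl _ (by omega), ih]; ring
  obtain ⟨B', hB'1, hB'2⟩ := ENNReal.lt_iff_exists_nnreal_btwn.1
    (max_lt hAB (show 1 < ENNReal.ofReal B by simpa using hB))
  have hB'A := (le_max_left _ _).trans_lt hB'1
  have hB'one : (1:ℝ) < B' := by exact_mod_cast (le_max_right _ _).trans_lt hB'1
  have hB'B : (B' : ℝ) < B := by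
    rw [← ENNReal.ofReal_coe_nnreal, ENNReal.ofReal_lt_ofReal_iff (by linarith)] at hB'2
    exact hB'2
  have hSN := Sseq_pos hψpos hψ hB N
  have hlim : Tendsto (fun m : ℕ => (B / B') ^ m) atTop atTop :=
    tendsto_pow_atTop_atTop_of_one_lt ((one_lt_div (by linarith)).2 hB'B)
  obtain ⟨M, hM⟩ := eventually_atTop.1
    (hlim.eventually_ge_atTop ((B':ℝ) ^ (N + 1) / ((B - 1) * Sseq ψ B N)))
  have hev : ∀ᶠ n : ℕ in atTop, ((Real.log B' : ℝ) : EReal) ≤ ((Real.log (ψ n) / n : ℝ) : EReal) := by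
    filter_upwards [eventually_ge_atTop (N + M + 1)] with n hn
    obtain ⟨m, rfl⟩ : ∃ m, n = N + m + 1 := ⟨n - N - 1, by omega⟩
    have h1 := hlt (N + m) (by omega)
    rw [hl _ (by omega), hS] at h1
    have h2 := hM m (by omega)
    rw [div_le_iff₀ (mul_pos (by linarith) hSN), div_pow, div_mul_eq_mul_div,
      le_div_iff₀ (by positivity), ← pow_add] at h2
    have h3 : (B' : ℝ) ^ (N + m + 1) ≤ ψ (N + m + 1) := by
      rw [show N + m + 1 = N + 1 + m by omega] at h1 ⊢
      linarith
    rw [EReal.coe_le_coe_iff, le_div_iff₀ (by positivity), mul_comm, ← Real.log_pow]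
    exact Real.log_le_log (by positivity) h3
  have h5 : ((Real.log B' : ℝ) : EReal) ≤ ENNReal.log A := by
    rw [hA]; exact le_liminf_of_le (by isBoundedDefault) hev
  rw [← ENNReal.log_ofReal_of_pos (by linarith), ENNReal.ofReal_coe_nnreal,
    ENNReal.log_le_log_iff] at h5
  exact absurd hB'A (not_lt.2 h5)

lemma lseq_log {ψ : ℕ → ℝ} (hψpos : ∀ n, 0 < ψ n)
    (hψ : Tendsto (fun n : ℕ => ψ n / Real.log n) atTop atTop) {B : ℝ}
    (hB : 1 < B) {K : ℝ} (hK : 0 < K) : ∀ᶠ n : ℕ in atTop, K * Real.log (n + 3) ≤ lseq ψ B n := by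
  have hψ' := psi_atTop hψ
  have hS : ∀ n : ℕ, n * lseq ψ B 0 ≤ Sseq ψ B n := by
    intro n
    induction n with
    | zero => simpa using (Sseq_pos hψpos hψ' hB 0).le
    | succ n ih =>
      rw [Sseq_succ]; push_cast
      linarith [lseq_mono hψpos hψ' hB (Nat.zero_le n)]
  have hl0 := lseq_pos hψpos hψ' hB 0
  obtain ⟨N, hN⟩ := eventually_atTop.1 (hψ.eventually_ge_atTop (2 * K))
  have hlog : ∀ᶠ n : ℕ in atTop, K * Real.log (n + 3) ≤ (B - 1) * (n * lseq ψ B 0) := by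
    have hc : 0 < (B - 1) * lseq ψ B 0 / K / 4 := by
      have : 0 < B - 1 := by linarith
      positivity
    have h1 := (Real.isLittleO_log_id_atTop.def hc)
    have h2 : Tendsto (fun n : ℕ => (n : ℝ) + 3) atTop atTop :=
      tendsto_atTop_add_const_right _ _ tendsto_natCast_atTop_atTop
    filter_upwards [h2.eventually h1, eventually_ge_atTop 1] with n hn hn1
    have hn1' : (1:ℝ) ≤ n := by exact_mod_cast hn1
    simp only [id, Real.norm_eq_abs] at hn
    rw [abs_of_nonneg (a := (n:ℝ) + 3) (by positivity)] at hn
    have h3 := (le_abs_self _).trans hn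
    have h4 := mul_le_mul_of_nonneg_left h3 hK.le
    have h5 : K * ((B - 1) * lseq ψ B 0 / K / 4 * ((n:ℝ) + 3)) =
      (B - 1) * lseq ψ B 0 * (((n:ℝ) + 3) / 4) := by field_simp
    rw [h5] at h4
    have h6 : 0 < (B - 1) * lseq ψ B 0 := mul_pos (by linarith) hl0
    nlinarith
  filter_upwards [hlog, eventually_ge_atTop (N + 1)] with n hn hnN
  apply le_min
  · obtain ⟨m, hm⟩ := phi_attained hψ' n
    rw [hm]
    have h1 := hN (n + 1 + m) (by omega)
    have h2 : 0 < Real.log ((n + 1 + m : ℕ) : ℝ) := Real.log_pos (by exact_mod_cast (by omega))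
    rw [le_div_iff₀ h2] at h1
    refine le_trans ?_ h1
    have h3 : Real.log (n + 3) ≤ 2 * Real.log ((n + 1 + m : ℕ) : ℝ) := by
      have : 2 * Real.log ((n + 1 + m : ℕ) : ℝ) = Real.log (((n + 1 + m : ℕ) : ℝ) ^ 2) := by
        rw [Real.log_pow]; norm_num
      rw [this]
      apply Real.log_le_log (by positivity)
      have h4 : (1:ℝ) ≤ n := by exact_mod_cast (by omega : 1 ≤ n)
      push_cast
      nlinarith [(Nat.cast_nonneg m : (0:ℝ) ≤ m)]
    nlinarith
  · refine hn.trans (mul_le_mul_of_nonneg_left (hS n) (by linarith))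

lemma Sseq_big {ψ : ℕ → ℝ} (hψpos : ∀ n, 0 < ψ n)
    (hψ : Tendsto (fun n : ℕ => ψ n / Real.log n) atTop atTop) {B : ℝ}
    (hB : 1 < B) {K : ℝ} (hK : 0 < K) : ∃ D : ℝ, ∀ n : ℕ,
      K * ∑ i ∈ Finset.range (n + 1), Real.log (i + 2) ≤ Sseq ψ B n + D := by
  obtain ⟨N, hN⟩ := eventually_atTop.1 (lseq_log hψpos hψ hB hK)
  have hSpos := fun n => Sseq_pos hψpos (psi_atTop hψ) hB n
  have hlogpos : ∀ i : ℕ, 0 ≤ Real.log ((i : ℝ) + 2) := fun i => Real.log_nonneg (by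
    linarith [(Nat.cast_nonneg i : (0:ℝ) ≤ i)])
  refine ⟨K * ∑ i ∈ Finset.range (N + 1), Real.log (i + 2), fun n => ?_⟩
  rcases le_total n N with h | h
  · have : ∑ i ∈ Finset.range (n + 1), Real.log ((i:ℝ) + 2) ≤
        ∑ i ∈ Finset.range (N + 1), Real.log ((i:ℝ) + 2) :=
      Finset.sum_le_sum_of_subset_of_nonneg (Finset.range_mono (by omega)) fun i _ _ => hlogpos i
    have := mul_le_mul_of_nonneg_left this hK.le
    linarith [hSpos n]
  · induction n, h using Nat.le_induction with
    | base => linarith [hSpos N]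
    | succ n hn ih =>
      rw [Finset.sum_range_succ, Sseq_succ, mul_add]
      have := hN n hn
      rw [show (((n + 1 : ℕ) : ℝ) + 2) = n + 3 by push_cast; ring]
      linarith

theorem lower_B (ψ : ℕ → ℝ) (hψpos : ∀ n, 0 < ψ n)
    (hψ : Tendsto (fun n : ℕ => ψ n / Real.log n) atTop atTop)
    (A : ℝ≥0∞) (B : ℝ) (hB : 1 < B) (hAB : A < ENNReal.ofReal B)
    (hA : ENNReal.log A =
      Filter.liminf (fun n : ℕ => ((Real.log (ψ n) / n : ℝ) : EReal)) atTop)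
    (σ : NNReal) (hσ : 0 < σ) (hσB : σ * (B + 1) < 1) :
    (σ : ℝ≥0∞) ≤ dimH {x | x ∈ Lam ∧
        Filter.limsup (fun n : ℕ => ((Real.log (cfA n x) / ψ n : ℝ) : EReal)) atTop =
          (1 : EReal)} := by
  have hψ' := psi_atTop hψ
  have hσ' : (0:ℝ) < σ := hσ
  have hσ2 : 2 * (σ:ℝ) < 1 := by nlinarith
  set l := lseq ψ B with hl
  set S := Sseq ψ B with hS
  have hl0 : ∀ n, 0 < l n := lseq_pos hψpos hψ' hB
  have hlmono : Monotone l := lseq_mono hψpos hψ' hB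
  have hS0 : ∀ n, 0 < S n := Sseq_pos hψpos hψ' hB
  let s : ℕ → ℕ := fun i => ⌊Real.exp (l i)⌋₊ + 2
  have hs2 : ∀ i, 2 ≤ s i := fun i => by simp [s]
  have hsmono : Monotone s := fun i j hij =>
    Nat.add_le_add_right (Nat.floor_le_floor (Real.exp_le_exp.2 (hlmono hij))) 2
  have hslow : ∀ i, Real.exp (l i) ≤ s i := fun i => by
    have := Nat.lt_floor_add_one (Real.exp (l i))
    simp only [s]; push_cast; linarith
  have hsup : ∀ i, (s i : ℝ) ≤ 3 * Real.exp (l i) := fun i => by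
    have := Nat.floor_le (Real.exp_pos (l i)).le
    have h1 := Real.one_le_exp (hl0 i).le
    simp only [s]; push_cast; linarith
  have hspos : ∀ i, (0:ℝ) < s i := fun i => by have := hs2 i; positivity
  have hll : ∀ i, l i ≤ Real.log (s i) := fun i =>
    (Real.le_log_iff_exp_le (hspos i)).2 (hslow i)
  have hlu : ∀ i, Real.log (s i) ≤ Real.log 3 + l i := fun i => by
    have := Real.log_le_log (hspos i) (hsup i)
    rwa [Real.log_mul (by norm_num) (Real.exp_pos _).ne', Real.log_exp] at this
  have hSsum : ∀ n, S n - 1 ≤ ∑ i ∈ Finset.range n, Real.log (s i) := by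
    intro n
    induction n with
    | zero => simp [hS, Sseq]
    | succ n ih =>
      rw [Finset.sum_range_succ, hS, Sseq_succ]
      have h1 := hll n
      rw [hl] at h1
      linarith
  -- constant
  set ε := 1 - σ * (B + 1) with hε
  have hε0 : 0 < ε := by linarith
  obtain ⟨D, hD⟩ := Sseq_big hψpos hψ hB (show 0 < 2 * (σ:ℝ) / ε by positivity)
  set C := Real.exp (Real.log 4 + Real.log 3 + ε * D + 1) with hC
  refine lower_core s hs2 hsmono σ hσ (by
    rw [← NNReal.coe_le_coe]; push_cast; linarith) C ?_ _ ?_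
  · intro n
    have hQ : (0:ℝ) < ∏ i ∈ Finset.range (n + 1), ((i : ℝ) + 2) :=
      Finset.prod_pos fun i _ => by positivity
    have hP : (0:ℝ) < ∏ i ∈ Finset.range (n + 1), (s i : ℝ) := Finset.prod_pos fun i _ => hspos i
    have hs0 := hspos n
    rw [← Real.log_le_log_iff (by positivity) (by positivity),
      Real.log_mul (by positivity) (by positivity), Real.log_mul (by positivity) (by positivity),
      Real.log_mul (by positivity) (by positivity), Real.log_mul (by positivity) (by positivity),
      Real.log_rpow hQ, Real.log_rpow hP, Real.log_rpow hs0,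
      Real.log_prod (fun i _ => by positivity), Real.log_prod (fun i _ => (hspos i).ne'),
      hC, Real.log_exp, Finset.sum_range_succ (fun i => Real.log (s i : ℝ))]
    have h1 := hD n
    set q := ∑ i ∈ Finset.range (n + 1), Real.log ((i:ℝ) + 2)
    set p := ∑ i ∈ Finset.range n, Real.log (s i : ℝ)
    have h2 : S n - 1 ≤ p := hSsum n
    have h3 : Real.log (s n) ≤ Real.log 3 + (B - 1) * S n :=
      (hlu n).trans (by gcongr; exact min_le_right _ _)
    have h4 : 2 * σ * q ≤ ε * (S n + D) := by
      have := mul_le_mul_of_nonneg_left h1 hε0.le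
      have e : ε * (2 * σ / ε * q) = 2 * σ * q := by field_simp
      rw [e] at this; exact this
    have h5 : σ * Real.log (s n) ≤ σ * (Real.log 3 + (B - 1) * S n) :=
      mul_le_mul_of_nonneg_left h3 hσ'.le
    have h6 : (1 - 2 * σ) * (S n - 1) ≤ (1 - 2 * σ) * p :=
      mul_le_mul_of_nonneg_left h2 (by linarith)
    have h7 : σ * Real.log 3 ≤ Real.log 3 := by
      have := Real.log_pos (by norm_num : (1:ℝ) < 3)
      nlinarith
    have h8 : ε * S n = S n - σ * (B + 1) * S n := by rw [hε]; ring
    nlinarith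
  · intro x hx hdig
    refine ⟨hx, le_antisymm ?_ ?_⟩
    · have hlim : Tendsto (fun n : ℕ => (2 * Real.log n + Real.log 3 + ψ n) / ψ n) atTop
          (nhds 1) := by
        have h1 : Tendsto (fun n : ℕ => (ψ n / Real.log n)⁻¹) atTop (nhds 0) :=
          tendsto_inv_atTop_zero.comp hψ
        have h2 : Tendsto (fun n : ℕ => (ψ n)⁻¹) atTop (nhds 0) :=
          tendsto_inv_atTop_zero.comp hψ'
        have h3 := ((h1.const_mul 2).add (h2.const_mul (Real.log 3))).add_const 1
        simp only [mul_zero, add_zero, zero_add] at h3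
        refine h3.congr fun n => ?_
        have := (hψpos n).ne'
        field_simp
      have hlim2 : Tendsto (fun n : ℕ => (((2 * Real.log n + Real.log 3 + ψ n) / ψ n : ℝ) : EReal))
          atTop (nhds (1 : EReal)) := by
        have := (continuous_coe_real_ereal.tendsto 1).comp hlim
        simpa [Function.comp_def] using this
      rw [← hlim2.limsup_eq]
      refine limsup_le_limsup ?_
      filter_upwards [eventually_ge_atTop 2] with n hn
      rw [EReal.coe_le_coe_iff]
      have hpn := hψpos n
      gcongr
      obtain ⟨m, rfl⟩ : ∃ m, n = m + 1 := ⟨n - 1, by omega⟩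
      have h1 : ((cfA (m + 1) x : ℕ) : ℝ) ≤ (m + 2) * s m := by
        exact_mod_cast (Nat.le_succ _).trans (hdig m).2
      have h0 : (0:ℝ) < cfA (m + 1) x := by exact_mod_cast Lam_one_le hx m
      have hm1 : (1:ℝ) ≤ m := by exact_mod_cast (by omega : 1 ≤ m)
      have h2 := Real.log_le_log h0 h1
      rw [Real.log_mul (by positivity) (hspos m).ne'] at h2
      have h3 : Real.log (m + 2) ≤ 2 * Real.log ((m + 1 : ℕ) : ℝ) := by
        have : 2 * Real.log ((m + 1 : ℕ) : ℝ) = Real.log (((m + 1 : ℕ) : ℝ) ^ 2) := by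
          rw [Real.log_pow]; norm_num
        rw [this]
        apply Real.log_le_log (by positivity)
        push_cast
        nlinarith
      have h4 : l m ≤ ψ (m + 1) := lseq_le hψpos B m
      linarith [hlu m]
    · refine le_limsup_of_frequently_le ?_
      · have h1 := lseq_freq hψpos hψ' hB hAB hA
        rw [frequently_atTop] at h1 ⊢
        intro N
        obtain ⟨n, hn, hn2⟩ := h1 N
        refine ⟨n + 1, by omega, ?_⟩
        have h2 : (1:ℝ) ≤ Real.log (cfA (n + 1) x) / ψ (n + 1) := by
          rw [le_div_iff₀ (hψpos _), one_mul, ← hn2]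
          refine (hll n).trans (Real.log_le_log (hspos n) ?_)
          have h3 : s n ≤ cfA (n + 1) x :=
            (Nat.le_mul_of_pos_left _ (by omega)).trans (hdig n).1
          exact_mod_cast h3
        exact_mod_cast h2

theorem lower (ψ : ℕ → ℝ) (hψpos : ∀ n, 0 < ψ n)
    (hψ : Tendsto (fun n : ℕ => ψ n / Real.log n) atTop atTop)
    (A : ℝ≥0∞) (hA1 : 1 ≤ A)
    (hA : ENNReal.log A =
      Filter.liminf (fun n : ℕ => ((Real.log (ψ n) / n : ℝ) : EReal)) atTop) :
    (A + 1)⁻¹ ≤ dimH {x | x ∈ Lam ∧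
        Filter.limsup (fun n : ℕ => ((Real.log (cfA n x) / ψ n : ℝ) : EReal)) atTop =
          (1 : EReal)} := by
  rcases eq_or_ne A ⊤ with rfl | hAtop
  · simp
  refine ENNReal.le_of_forall_nnreal_lt fun σ hσ => ?_
  rcases eq_or_ne σ 0 with rfl | hσ0
  · simp
  have hσpos : 0 < σ := pos_iff_ne_zero.2 hσ0
  have hσ' : (0:ℝ) < σ := hσpos
  lift A to NNReal using hAtop
  have hAone : (1:ℝ) ≤ A := by exact_mod_cast hA1
  have h1 : (σ:ℝ) < ((A:ℝ) + 1)⁻¹ := by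
    have : ((A : ℝ≥0∞) + 1)⁻¹ = ((A + 1)⁻¹ : NNReal) := by
      rw [ENNReal.coe_inv (by positivity)]; simp
    rw [this] at hσ
    exact_mod_cast hσ
  have h2 : (A:ℝ) < 1 / σ - 1 := by
    rw [lt_inv_comm₀ hσ' (by linarith)] at h1
    rw [one_div]; linarith
  obtain ⟨B, hB1, hB2⟩ := exists_between h2
  refine lower_B ψ hψpos hψ A B (by linarith) ?_ hA σ hσpos ?_
  · rw [← ENNReal.ofReal_coe_nnreal]
    exact (ENNReal.ofReal_lt_ofReal_iff (by linarith)).2 hB1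
  · rw [lt_sub_iff_add_lt, lt_div_iff₀ hσ'] at hB2
    linarith

/-- If `ψ(n)/log n → ∞` and `log A = liminf (log ψ(n))/n` with `A ∈ [1,∞]`, then
`E_sup(Λ,ψ)` has Hausdorff dimension `1/(A+1)`. -/
theorem dimH_Esup_Lam_fast (ψ : ℕ → ℝ) (hψpos : ∀ n, 0 < ψ n)
    (hψ : Tendsto (fun n : ℕ => ψ n / Real.log n) atTop atTop)
    (A : ℝ≥0∞) (hA1 : 1 ≤ A)
    (hA : ENNReal.log A =
      Filter.liminf (fun n : ℕ => ((Real.log (ψ n) / n : ℝ) : EReal)) atTop) :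
    dimH {x | x ∈ Lam ∧
        Filter.limsup (fun n : ℕ => ((Real.log (cfA n x) / ψ n : ℝ) : EReal)) atTop =
          (1 : EReal)} =
      (A + 1)⁻¹ := by
  exact le_antisymm (upper ψ hψpos hψ A hA1 hA) (lower ψ hψpos hψ A hA1 hA)
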